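/- Let f : ℝ^d → ℝ be convex, twice continuously differentiable with positive definite Hessian everywhere, and semi-strongly self-concordant with constant L_semi > 0. Let x_k ∈ ℝ^d, let B_k be an (α̲, ᾱ)-relative inexact Hessian of f at x_k with α_max := max(α̲, ᾱ), let α > 0 satisfy α ≥ α_max, set θ := 1 + α, let L ≥ (1 + ᾱ)^{3/2} L_semi, and let x_{k+1} := x_k − η_k B_k⁻¹ ∇f(x_k) be the CEQN step with these parameters. Then f(x_k) − f(x_{k+1}) ≥ min{ (1/(4α)) (‖∇f(x_{k+1})‖_{B_k}^*)², (1/(6L))^{1/2} (‖∇f(x_{k+1})‖_{B_k}^*)^{3/2} } ≥ 0. -/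

import Mathlib

open scoped RealInnerProductSpace

/-- The action of a `d × d` matrix on a vector of `EuclideanSpace ℝ (Fin d)`. -/
noncomputable def mulV {d : ℕ} (B : Matrix (Fin d) (Fin d) ℝ)
    (v : EuclideanSpace ℝ (Fin d)) : EuclideanSpace ℝ (Fin d) :=
  (EuclideanSpace.equiv (Fin d) ℝ).symm (B.mulVec ((EuclideanSpace.equiv (Fin d) ℝ) v))

/-- The `B`-norm `‖h‖_B = ⟨h, B h⟩^{1/2}`. -/
noncomputable def normB {d : ℕ} (B : Matrix (Fin d) (Fin d) ℝ)
    (h : EuclideanSpace ℝ (Fin d)) : ℝ :=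
  Real.sqrt ⟪h, mulV B h⟫

/-- The dual norm `‖g‖_B^* = ⟨g, B⁻¹ g⟩^{1/2}`. -/
noncomputable def dualNormB {d : ℕ} (B : Matrix (Fin d) (Fin d) ℝ)
    (g : EuclideanSpace ℝ (Fin d)) : ℝ :=
  Real.sqrt ⟪g, mulV B⁻¹ g⟫

/-- The Hessian of `f` at `x`, as a `d × d` matrix (matrix of the Fréchet derivative
of the gradient). -/
noncomputable def hessM {d : ℕ} (f : EuclideanSpace ℝ (Fin d) → ℝ)
    (x : EuclideanSpace ℝ (Fin d)) : Matrix (Fin d) (Fin d) ℝ :=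
  fun i j => (fderiv ℝ (gradient f) x (EuclideanSpace.single j (1 : ℝ))) i

/-- `f` is semi-strongly self-concordant with constant `Ls`:
`‖(∇²f(y) − ∇²f(x)) h‖_{∇²f(x)}^* ≤ Ls ‖y − x‖_{∇²f(x)} ‖h‖_{∇²f(x)}` for all `x y h`. -/
def SemiStrongSelfConcordant {d : ℕ} (f : EuclideanSpace ℝ (Fin d) → ℝ) (Ls : ℝ) : Prop :=
  ∀ x y h : EuclideanSpace ℝ (Fin d),
    dualNormB (hessM f x) (mulV (hessM f y - hessM f x) h) ≤
      Ls * normB (hessM f x) (y - x) * normB (hessM f x) h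

/-- `Bx` is an `(al, au)`-relative inexact Hessian of `f` at `x`:
`Bx` is symmetric positive definite, `0 ≤ al ≤ 1`, `0 ≤ au`, and
`(1 − al) Bx ⪯ ∇²f(x) ⪯ (1 + au) Bx` in the Loewner order. -/
def RelInexactHessian {d : ℕ} (f : EuclideanSpace ℝ (Fin d) → ℝ)
    (x : EuclideanSpace ℝ (Fin d)) (al au : ℝ) (Bx : Matrix (Fin d) (Fin d) ℝ) : Prop :=
  0 ≤ al ∧ al ≤ 1 ∧ 0 ≤ au ∧ Bx.PosDef ∧
    (hessM f x - (1 - al) • Bx).PosSemidef ∧ ((1 + au) • Bx - hessM f x).PosSemidef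

/-- The inexact second-order model
`Q̄_f(y;x) = f(x) + ⟨∇f(x), y − x⟩ + ½⟨B_x(y − x), y − x⟩`. -/
noncomputable def Qbar {d : ℕ} (f : EuclideanSpace ℝ (Fin d) → ℝ)
    (Bx : Matrix (Fin d) (Fin d) ℝ) (x y : EuclideanSpace ℝ (Fin d)) : ℝ :=
  f x + ⟪gradient f x, y - x⟫ + (1 / 2) * ⟪mulV Bx (y - x), y - x⟫

section helpers
variable {d : ℕ}

lemma mulV_add (B : Matrix (Fin d) (Fin d) ℝ) (u v : EuclideanSpace ℝ (Fin d)) :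
    mulV B (u + v) = mulV B u + mulV B v := by
  simp [mulV, Matrix.mulVec_add]

lemma mulV_smul (B : Matrix (Fin d) (Fin d) ℝ) (c : ℝ) (v : EuclideanSpace ℝ (Fin d)) :
    mulV B (c • v) = c • mulV B v := by
  simp [mulV, Matrix.mulVec_smul]

lemma mulV_sub (B : Matrix (Fin d) (Fin d) ℝ) (u v : EuclideanSpace ℝ (Fin d)) :
    mulV B (u - v) = mulV B u - mulV B v := by
  simp [mulV, Matrix.mulVec_sub]

lemma sub_mulV (A B : Matrix (Fin d) (Fin d) ℝ) (v : EuclideanSpace ℝ (Fin d)) :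
    mulV (A - B) v = mulV A v - mulV B v := by
  simp [mulV, Matrix.sub_mulVec]

lemma smul_mulV (c : ℝ) (B : Matrix (Fin d) (Fin d) ℝ) (v : EuclideanSpace ℝ (Fin d)) :
    mulV (c • B) v = c • mulV B v := by
  simp [mulV, Matrix.smul_mulVec]

lemma mulV_inv (B : Matrix (Fin d) (Fin d) ℝ) (hB : B.PosDef) (v : EuclideanSpace ℝ (Fin d)) :
    mulV B (mulV B⁻¹ v) = v := by
  have h : B * B⁻¹ = 1 := Matrix.mul_nonsing_inv _ hB.det_pos.ne'.isUnit
  change WithLp.toLp 2 (B.mulVec (B⁻¹.mulVec v.ofLp)) = v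
  rw [Matrix.mulVec_mulVec, h, Matrix.one_mulVec]

lemma inner_mulV (B : Matrix (Fin d) (Fin d) ℝ) (u v : EuclideanSpace ℝ (Fin d)) :
    ⟪u, mulV B v⟫ = u.ofLp ⬝ᵥ B.mulVec v.ofLp := by
  rw [EuclideanSpace.inner_eq_star_dotProduct, dotProduct_comm]
  rfl

lemma mulV_symm (B : Matrix (Fin d) (Fin d) ℝ) (hB : B.IsHermitian)
    (u v : EuclideanSpace ℝ (Fin d)) : ⟪u, mulV B v⟫ = ⟪v, mulV B u⟫ := by
  have hT : B.transpose = B := by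
    rw [← Matrix.conjTranspose_eq_transpose_of_trivial]; exact hB
  rw [inner_mulV, inner_mulV, Matrix.dotProduct_mulVec, dotProduct_comm]
  congr 1
  rw [← Matrix.mulVec_transpose, hT]

lemma mulV_nonneg (B : Matrix (Fin d) (Fin d) ℝ) (hB : B.PosSemidef)
    (u : EuclideanSpace ℝ (Fin d)) : 0 ≤ ⟪u, mulV B u⟫ := by
  rw [inner_mulV]
  simpa using hB.dotProduct_mulVec_nonneg u.ofLp

lemma mulV_pos (B : Matrix (Fin d) (Fin d) ℝ) (hB : B.PosDef)
    (u : EuclideanSpace ℝ (Fin d)) (hu : u ≠ 0) : 0 < ⟪u, mulV B u⟫ := by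
  rw [inner_mulV]
  have : u.ofLp ≠ 0 := by
    intro h; apply hu; ext i; simp [h]
  simpa using hB.dotProduct_mulVec_pos this

lemma normB_nonneg (B : Matrix (Fin d) (Fin d) ℝ) (u : EuclideanSpace ℝ (Fin d)) :
    0 ≤ normB B u := Real.sqrt_nonneg _

lemma normB_sq (B : Matrix (Fin d) (Fin d) ℝ) (hB : B.PosDef) (u : EuclideanSpace ℝ (Fin d)) :
    normB B u ^ 2 = ⟪u, mulV B u⟫ := Real.sq_sqrt (mulV_nonneg B hB.posSemidef u)

lemma dualNormB_eq (B : Matrix (Fin d) (Fin d) ℝ) (hB : B.PosDef)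
    (u : EuclideanSpace ℝ (Fin d)) : dualNormB B u = normB B (mulV B⁻¹ u) := by
  rw [dualNormB, normB, mulV_inv B hB, real_inner_comm]

lemma bil_bound (A B : Matrix (Fin d) (Fin d) ℝ) (hA : A.IsHermitian) (hB : B.PosDef) (c : ℝ)
    (h1 : ∀ u, ⟪u, mulV A u⟫ ≤ c * ⟪u, mulV B u⟫)
    (h2 : ∀ u, -(c * ⟪u, mulV B u⟫) ≤ ⟪u, mulV A u⟫) (v h : EuclideanSpace ℝ (Fin d)) :
    ⟪v, mulV A h⟫ ≤ c * normB B v * normB B h := by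
  by_cases hv : v = 0
  · subst hv; simp [normB]
  by_cases hh : h = 0
  · subst hh; simp [normB, mulV]
  have a0 : 0 < normB B v := Real.sqrt_pos.2 (mulV_pos B hB v hv)
  have b0 : 0 < normB B h := Real.sqrt_pos.2 (mulV_pos B hB h hh)
  have ha := normB_sq B hB v
  have hb := normB_sq B hB h
  set a := normB B v
  set b := normB B h
  have e1 := h1 (b • v + a • h)
  have e2 := h2 (b • v - a • h)
  simp only [mulV_add, mulV_sub, mulV_smul, inner_add_left, inner_add_right, inner_sub_left,
    inner_sub_right, real_inner_smul_left, real_inner_smul_right, mulV_symm A hA h v,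
    mulV_symm B hB.1 h v, ← ha, ← hb] at e1 e2
  have : (a * b) * ⟪v, mulV A h⟫ ≤ (a * b) * (c * a * b) := by nlinarith
  exact le_of_mul_le_mul_left this (mul_pos a0 b0)

lemma cs_dual (B : Matrix (Fin d) (Fin d) ℝ) (hB : B.PosDef) (v w : EuclideanSpace ℝ (Fin d)) :
    ⟪v, w⟫ ≤ normB B v * dualNormB B w := by
  have := bil_bound B B hB.1 hB 1 (fun u => by simp)
    (fun u => by have := mulV_nonneg B hB.posSemidef u; linarith) v (mulV B⁻¹ w)
  rwa [mulV_inv B hB, one_mul, ← dualNormB_eq B hB] at this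

lemma hess_apply (f : EuclideanSpace ℝ (Fin d) → ℝ) (x h : EuclideanSpace ℝ (Fin d)) :
    fderiv ℝ (gradient f) x h = mulV (hessM f x) h := by
  have hh : h = ∑ j, h j • EuclideanSpace.single j (1 : ℝ) := by
    ext i
    simp [Finset.sum_apply, Pi.single_apply]
  ext i
  conv_lhs => rw [hh]
  simp [mulV, Matrix.mulVec, dotProduct, hessM, mul_comm]

lemma grad_diff (f : EuclideanSpace ℝ (Fin d) → ℝ) (hC2 : ContDiff ℝ 2 f) :
    Differentiable ℝ (gradient f) := by
  have h1 : ContDiff ℝ 1 (fderiv ℝ f) := hC2.fderiv_right (by norm_num)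
  have h2 : Differentiable ℝ (fderiv ℝ f) := h1.differentiable (by norm_num)
  have : gradient f = fun x => (InnerProductSpace.toDual ℝ (EuclideanSpace ℝ (Fin d))).symm
      (fderiv ℝ f x) := rfl
  rw [this]
  exact (InnerProductSpace.toDual ℝ
    (EuclideanSpace ℝ (Fin d))).symm.toContinuousLinearEquiv.differentiable.comp h2

lemma convex_grad (f : EuclideanSpace ℝ (Fin d) → ℝ) (hconv : ConvexOn ℝ Set.univ f)
    (hC2 : ContDiff ℝ 2 f) (y h : EuclideanSpace ℝ (Fin d)) :
    f y + ⟪gradient f y, h⟫ ≤ f (y + h) := by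
  have hd : DifferentiableAt ℝ f y := hC2.differentiable (by norm_num) y
  have hl : HasDerivAt (fun t : ℝ => y + t • h) h 0 := by
    simpa using ((hasDerivAt_id (0:ℝ)).smul_const h).const_add y
  have hF : HasFDerivAt f (fderiv ℝ f y) (y + (0:ℝ) • h) := by simpa using hd.hasFDerivAt
  have hc := hF.comp_hasDerivAt (0:ℝ) hl
  have hcv : ConvexOn ℝ Set.univ (f ∘ fun t : ℝ => y + t • h) := by
    have := hconv.comp_affineMap (AffineMap.lineMap y (y + h) : ℝ →ᵃ[ℝ] EuclideanSpace ℝ (Fin d))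
    simp only [Set.preimage_univ] at this
    have he : (fun t : ℝ => y + t • h) =
        (AffineMap.lineMap y (y + h) : ℝ →ᵃ[ℝ] EuclideanSpace ℝ (Fin d)) := by
      funext t
      simp [AffineMap.lineMap_apply, add_comm]
    rw [he]
    exact this
  have := hcv.le_slope_of_hasDerivAt (Set.mem_univ 0) (Set.mem_univ 1) one_pos hc
  have hg : fderiv ℝ f y h = ⟪gradient f y, h⟫ := by
    rw [← toDual_gradient]; simp
  rw [hg, slope_def_field] at this
  simp only [Function.comp_apply, one_smul, zero_smul, add_zero, sub_zero, div_one] at this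
  linarith

lemma taylor_bound (f : EuclideanSpace ℝ (Fin d) → ℝ) (hC2 : ContDiff ℝ 2 f)
    (hpd : ∀ x, (hessM f x).PosDef) (Ls : ℝ) (hssc : SemiStrongSelfConcordant f Ls)
    (x h v : EuclideanSpace ℝ (Fin d)) :
    ⟪v, gradient f (x + h) - gradient f x - mulV (hessM f x) h⟫ ≤
      Ls / 2 * normB (hessM f x) h ^ 2 * normB (hessM f x) v := by
  set C := Ls * normB (hessM f x) h ^ 2 * normB (hessM f x) v with hC
  set q := ⟪v, mulV (hessM f x) h⟫ with hq
  have hder : ∀ t : ℝ, HasDerivAt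
      (fun t : ℝ => ⟪v, gradient f (x + t • h)⟫ - t * q - C / 2 * t ^ 2)
      (⟪v, mulV (hessM f (x + t • h)) h⟫ - q - C * t) t := by
    intro t
    have hl : HasDerivAt (fun t : ℝ => x + t • h) h t := by
      simpa using ((hasDerivAt_id t).smul_const h).const_add x
    have hg := ((grad_diff f hC2) (x + t • h)).hasFDerivAt.comp_hasDerivAt t hl
    rw [hess_apply] at hg
    have h1 := (hasDerivAt_const t v).inner ℝ hg
    have h2 := (h1.sub ((hasDerivAt_id t).mul_const q)).sub
      (((hasDerivAt_id t).pow 2).const_mul (C / 2))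
    have e : ⟪v, mulV (hessM f (x + t • h)) h⟫ - q - C * t =
        ⟪v, mulV (hessM f (x + t • h)) h⟫ + ⟪(0 : EuclideanSpace ℝ (Fin d)),
          (gradient f ∘ fun t : ℝ => x + t • h) t⟫ - 1 * q
          - C / 2 * (((2 : ℕ) : ℝ) * id t ^ (2 - 1) * 1) := by
      rw [inner_zero_left]
      norm_num
      ring
    rw [e]
    exact h2
  have hneg : ∀ t ∈ Set.Icc (0:ℝ) 1,
      ⟪v, mulV (hessM f (x + t • h)) h⟫ - q - C * t ≤ 0 := by
    intro t ht
    have e1 := hssc x (x + t • h) h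
    have e2 := cs_dual (hessM f x) (hpd x) v (mulV (hessM f (x + t • h) - hessM f x) h)
    have e3 : normB (hessM f x) (x + t • h - x) = t * normB (hessM f x) h := by
      rw [add_sub_cancel_left, normB, mulV_smul, real_inner_smul_left, real_inner_smul_right,
        ← mul_assoc, Real.sqrt_mul (mul_self_nonneg t), Real.sqrt_mul_self ht.1, normB]
    rw [e3] at e1
    have e4 := mul_le_mul_of_nonneg_left e1 (normB_nonneg (hessM f x) v)
    rw [sub_mulV, inner_sub_right] at e2
    rw [sub_mulV] at e4
    rw [hC]
    linarith
  have hanti := antitoneOn_of_deriv_nonpos (convex_Icc (0:ℝ) 1)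
    (fun t _ => (hder t).continuousAt.continuousWithinAt)
    (fun t _ => (hder t).differentiableAt.differentiableWithinAt)
    (fun t ht => by rw [(hder t).deriv]; exact hneg t (interior_subset ht))
  have := hanti (Set.left_mem_Icc.2 zero_le_one) (Set.right_mem_Icc.2 zero_le_one) zero_le_one
  simp only [one_smul, zero_smul, add_zero] at this
  rw [inner_sub_right, inner_sub_right]
  linarith

lemma scalar_final (α L r G D : ℝ) (hα : 0 < α) (hL : 0 < L) (hr : 0 ≤ r) (hG : 0 ≤ G)
    (h : G ^ 2 + α * L * r ^ 3 + 3 / 4 * L ^ 2 * r ^ 4 ≤ 2 * (α + L * r) * D) :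
    min (1 / (4 * α) * G ^ 2) ((1 / (6 * L)) ^ ((1 : ℝ) / 2) * G ^ ((3 : ℝ) / 2)) ≤ D := by
  have hLr : 0 ≤ L * r := by positivity
  have hD : 0 ≤ D := by
    have : 0 ≤ 2 * (α + L * r) * D := le_trans (by positivity) h
    exact nonneg_of_mul_nonneg_right this (by positivity)
  rcases le_total (L * r) α with hc | hc
  · apply min_le_of_left_le
    rw [div_mul_eq_mul_div, one_mul, div_le_iff₀ (by positivity)]
    have : 0 ≤ α * L * r ^ 3 + 3 / 4 * L ^ 2 * r ^ 4 := by positivity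
    nlinarith [mul_nonneg (sub_nonneg.2 hc) hD]
  · apply min_le_of_right_le
    have hrpos : 0 < r := by
      by_contra hn
      have : r = 0 := le_antisymm (not_lt.1 hn) hr
      subst this; simp at hc; linarith
    have h1 : G ^ 2 + 3 / 4 * (L * r ^ 2) ^ 2 ≤ 4 * (L * r) * D := by
      have : 0 ≤ α * L * r ^ 3 := by positivity
      nlinarith [mul_nonneg (sub_nonneg.2 hc) hD]
    have hy : 0 < L * r ^ 2 := by positivity
    obtain ⟨y, hyd⟩ : ∃ y, y = L * r ^ 2 := ⟨_, rfl⟩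
    rw [← hyd] at h1 hy
    have h2 : (G ^ 2 + 3 / 4 * y ^ 2) ^ 2 ≤ (4 * (L * r) * D) ^ 2 := by
      apply pow_le_pow_left₀ (by positivity) h1
    have h3 : 16 * y * G ^ 3 ≤ 6 * (G ^ 2 + 3 / 4 * y ^ 2) ^ 2 := by
      have : 0 ≤ (3 * y - 2 * G) ^ 2 * (27 * y ^ 2 + 36 * y * G + 108 * G ^ 2) := by positivity
      nlinarith
    have h4 : y * G ^ 3 ≤ y * (6 * L * D ^ 2) := by
      have : (4 * (L * r) * D) ^ 2 = 16 * y * L * D ^ 2 := by rw [hyd]; ring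
      nlinarith
    have h5 : G ^ 3 ≤ 6 * L * D ^ 2 := le_of_mul_le_mul_left h4 hy
    apply le_of_sq_le_sq _ hD
    rw [mul_pow, ← Real.rpow_natCast, ← Real.rpow_natCast (G ^ _), ← Real.rpow_mul (by positivity),
      ← Real.rpow_mul hG]
    have a1 : ((1:ℝ) / 2) * ((2:ℕ):ℝ) = 1 := by norm_num
    have a2 : ((3:ℝ) / 2) * ((2:ℕ):ℝ) = ((3:ℕ):ℝ) := by norm_num
    rw [a1, a2, Real.rpow_one, Real.rpow_natCast, div_mul_eq_mul_div, one_mul,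
      div_le_iff₀ (by positivity)]
    linarith

end helpers

set_option maxHeartbeats 2000000

/-- one-step decrease of the CEQN method. -/
theorem stmt7 {d : ℕ} (f : EuclideanSpace ℝ (Fin d) → ℝ)
    (hconv : ConvexOn ℝ Set.univ f) (hC2 : ContDiff ℝ 2 f)
    (hpd : ∀ x, (hessM f x).PosDef)
    (Ls : ℝ) (hLs : 0 < Ls) (hssc : SemiStrongSelfConcordant f Ls)
    (xk : EuclideanSpace ℝ (Fin d)) (al au : ℝ) (Bk : Matrix (Fin d) (Fin d) ℝ)
    (hrel : RelInexactHessian f xk al au Bk)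
    (α : ℝ) (hα : 0 < α) (hαmax : max al au ≤ α)
    (L : ℝ) (hL : (1 + au) ^ ((3 : ℝ) / 2) * Ls ≤ L)
    (η : ℝ) (hη : 0 < η)
    (heq : L * η ^ 2 * dualNormB Bk (gradient f xk) + (1 + α) * η = 1)
    (xk1 : EuclideanSpace ℝ (Fin d))
    (hstep : xk1 = xk - η • mulV Bk⁻¹ (gradient f xk)) :
    min (1 / (4 * α) * (dualNormB Bk (gradient f xk1)) ^ 2)
        ((1 / (6 * L)) ^ ((1 : ℝ) / 2) * (dualNormB Bk (gradient f xk1)) ^ ((3 : ℝ) / 2)) ≤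
      f xk - f xk1 ∧
    0 ≤ min (1 / (4 * α) * (dualNormB Bk (gradient f xk1)) ^ 2)
        ((1 / (6 * L)) ^ ((1 : ℝ) / 2) * (dualNormB Bk (gradient f xk1)) ^ ((3 : ℝ) / 2)) := by
  obtain ⟨hal0, hal1, hau0, hB, hlow, hup⟩ := hrel
  have hau1 : 0 < (1 + au) ^ ((3 : ℝ) / 2) := by positivity
  have hLpos : 0 < L := lt_of_lt_of_le (by positivity) hL
  have hGnn : ∀ g, 0 ≤ dualNormB Bk g := fun g => Real.sqrt_nonneg _
  have hG0 := hGnn (gradient f xk1)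
  refine ⟨?_, by positivity⟩
  set g := gradient f xk with hg
  set g1 := gradient f xk1 with hg1
  set H := hessM f xk with hH
  obtain ⟨h, hh⟩ : ∃ h, h = -(η • mulV Bk⁻¹ g) := ⟨_, rfl⟩
  have hx1 : xk1 = xk + h := by rw [hstep, hh, sub_eq_add_neg]
  set r := normB Bk h with hr
  have hr0 : 0 ≤ r := normB_nonneg _ _
  have hBh : mulV Bk h = -(η • g) := by
    rw [hh, ← neg_smul, mulV_smul, mulV_inv Bk hB, neg_smul]
  have hrη : r = η * dualNormB Bk g := by
    rw [hr, hh, ← neg_smul, dualNormB_eq Bk hB, normB, mulV_smul, real_inner_smul_left,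
      real_inner_smul_right, ← mul_assoc, Real.sqrt_mul (mul_self_nonneg _), neg_mul_neg,
      Real.sqrt_mul_self hη.le, normB]
  have hcoef : (1 + α + L * r) * η = 1 := by rw [hrη]; linarith
  have hgB : g = -((1 + α + L * r) • mulV Bk h) := by
    rw [hBh, smul_neg, neg_neg, smul_smul, hcoef, one_smul]
  have hal : al ≤ α := (le_max_left _ _).trans hαmax
  have hau : au ≤ α := (le_max_right _ _).trans hαmax
  -- quadratic form comparisons
  have hBn : ∀ u, 0 ≤ ⟪u, mulV Bk u⟫ := mulV_nonneg Bk hB.posSemidef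
  have hlow' : ∀ u, (1 - al) * ⟪u, mulV Bk u⟫ ≤ ⟪u, mulV H u⟫ := by
    intro u
    have := mulV_nonneg _ hlow u
    rw [sub_mulV, smul_mulV, inner_sub_right, real_inner_smul_right] at this
    linarith
  have hup' : ∀ u, ⟪u, mulV H u⟫ ≤ (1 + au) * ⟪u, mulV Bk u⟫ := by
    intro u
    have := mulV_nonneg _ hup u
    rw [sub_mulV, smul_mulV, inner_sub_right, real_inner_smul_right] at this
    linarith
  have hHB : ∀ v, ⟪v, mulV (H - Bk) h⟫ ≤ α * normB Bk v * r := by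
    intro v
    apply bil_bound (H - Bk) Bk ((hpd xk).1.sub hB.1) hB α
    · intro u
      rw [sub_mulV, inner_sub_right]
      nlinarith [hup' u, hBn u, mul_nonneg (sub_nonneg.2 hau) (hBn u)]
    · intro u
      rw [sub_mulV, inner_sub_right]
      nlinarith [hlow' u, hBn u, mul_nonneg (sub_nonneg.2 hal) (hBn u)]
  set s := Real.sqrt (1 + au) with hs
  have hs0 : 0 ≤ s := Real.sqrt_nonneg _
  have hs2 : s ^ 2 = 1 + au := Real.sq_sqrt (by linarith)
  have hs3 : (1 + au) ^ ((3 : ℝ) / 2) = s ^ 3 := by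
    rw [hs, Real.sqrt_eq_rpow, ← Real.rpow_natCast, ← Real.rpow_mul (by linarith)]
    norm_num
  have hnH : ∀ u, normB H u ≤ s * normB Bk u := by
    intro u
    rw [normB, normB, hs, ← Real.sqrt_mul (by linarith)]
    exact Real.sqrt_le_sqrt (hup' u)
  have hT : ∀ v, ⟪v, g1 - g - mulV H h⟫ ≤ L / 2 * r ^ 2 * normB Bk v := by
    intro v
    have e := taylor_bound f hC2 hpd Ls hssc xk h v
    rw [← hx1, ← hg, ← hg1, ← hH] at e
    refine e.trans ?_
    have e1 : normB H h ^ 2 ≤ (s * r) ^ 2 := pow_le_pow_left₀ (normB_nonneg _ _) (hnH h) 2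
    have e2 : normB H h ^ 2 * normB H v ≤ (s * r) ^ 2 * (s * normB Bk v) :=
      mul_le_mul e1 (hnH v) (normB_nonneg _ _) (by positivity)
    have e3 : 0 ≤ r ^ 2 * normB Bk v := mul_nonneg (by positivity) (normB_nonneg _ _)
    rw [hs3] at hL
    have e4 := mul_le_mul_of_nonneg_right hL e3
    have e5 := mul_le_mul_of_nonneg_left e2 hLs.le
    nlinarith
  -- the residual
  set w := g1 + (α + L * r) • mulV Bk h with hw
  have hw' : w = mulV (H - Bk) h + (g1 - g - mulV H h) := by
    rw [hw, sub_mulV]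
    conv_rhs => rw [hgB]
    module
  set c := α * r + L / 2 * r ^ 2 with hc
  have hwb : dualNormB Bk w ≤ c := by
    have e1 := hHB (mulV Bk⁻¹ w)
    have e2 := hT (mulV Bk⁻¹ w)
    have e3 : ⟪mulV Bk⁻¹ w, w⟫ ≤ c * dualNormB Bk w := by
      conv_lhs => rw [hw', inner_add_right, ← hw']
      rw [dualNormB_eq Bk hB, hc]
      linarith
    have e4 : ⟪mulV Bk⁻¹ w, w⟫ = dualNormB Bk w ^ 2 := by
      rw [dualNormB_eq Bk hB, normB_sq Bk hB, mulV_inv Bk hB]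
    rw [e4] at e3
    rcases (hGnn w).eq_or_lt with h0 | h0
    · rw [← h0]; positivity
    · nlinarith
  have hwsq : dualNormB Bk w ^ 2 ≤ c ^ 2 := pow_le_pow_left₀ (hGnn w) hwb 2
  have hexp : dualNormB Bk w ^ 2 =
      dualNormB Bk g1 ^ 2 + 2 * (α + L * r) * ⟪g1, h⟫ + (α + L * r) ^ 2 * r ^ 2 := by
    have hinv : mulV Bk⁻¹ (mulV Bk h) = h := by
      rw [hBh, ← neg_smul, mulV_smul, hh, neg_smul]
    have hwi : mulV Bk⁻¹ w = mulV Bk⁻¹ g1 + (α + L * r) • h := by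
      rw [hw, mulV_add, mulV_smul, hinv]
    rw [dualNormB_eq Bk hB, normB_sq Bk hB, mulV_inv Bk hB, hwi, dualNormB_eq Bk hB,
      normB_sq Bk hB, mulV_inv Bk hB, hr, normB_sq Bk hB, hw]
    have e5 : ⟪mulV Bk⁻¹ g1, mulV Bk h⟫ = ⟪g1, h⟫ := by
      rw [mulV_symm Bk hB.1, mulV_inv Bk hB, real_inner_comm]
    simp only [inner_add_left, inner_add_right, real_inner_smul_left, real_inner_smul_right, e5,
      real_inner_comm g1 h]
    ring
  have hcv := convex_grad f hconv hC2 xk1 (-h)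
  rw [hx1, add_neg_cancel_right, ← hx1, ← hg1, inner_neg_right] at hcv
  apply scalar_final α L r _ _ hα hLpos hr0 hG0
  have hpos : 0 ≤ 2 * (α + L * r) := by positivity
  have := mul_le_mul_of_nonneg_left (show -⟪g1, h⟫ ≤ f xk - f xk1 by linarith) hpos
  refine le_trans ?_ this
  rw [hexp, hc] at hwsq
  nlinarith
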